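/- Let P : C →_A C' be an execution step and let u be a node with u ∉ A ∪ B and children'(u) ∩ A_b = ∅. Then u ∉ B'. -/

import Mathlib

open scoped Classical

/-- A pre-configuration: a finite node set `V` with a partial parent map
(`none` means the node has no parent) and an integer height assignment. -/
structure PreConfig (V : Type*) where
  parent : V → Option V
  height : V → ℤ

namespace PreConfig

variable {V : Type*} [Fintype V] [LinearOrder V]

/-- The children of `u` are the nodes whose parent is `u`. -/
noncomputable def children (C : PreConfig V) (u : V) : Finset V :=
  Finset.univ.filter (fun v => C.parent v = some u)

/-- A leaf is a node with no children. -/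
def IsLeaf (C : PreConfig V) (u : V) : Prop := C.children u = ∅

/-- Maximum height value among the children of `u` (junk value `0` for a leaf). -/
noncomputable def maxH (C : PreConfig V) (u : V) : ℤ :=
  if h : (C.children u).Nonempty then (C.children u).sup' h C.height else 0

/-- Minimum height value among the children of `u` (junk value `0` for a leaf). -/
noncomputable def minH (C : PreConfig V) (u : V) : ℤ :=
  if h : (C.children u).Nonempty then (C.children u).inf' h C.height else 0

/-- A child of `u` of maximum height value; ties broken by a fixed rule
(smallest ID). Junk value `u` for a leaf. -/
noncomputable def maxChild (C : PreConfig V) (u : V) : V :=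
  if h : ((C.children u).filter fun v => C.height v = C.maxH u).Nonempty
  then ((C.children u).filter fun v => C.height v = C.maxH u).min' h else u

/-- A child of `u` of minimum height value; ties broken by a fixed rule
(smallest ID). Junk value `u` for a leaf. -/
noncomputable def minChild (C : PreConfig V) (u : V) : V :=
  if h : ((C.children u).filter fun v => C.height v = C.minH u).Nonempty
  then ((C.children u).filter fun v => C.height v = C.minH u).min' h else u

/-- `stable(u)`: `h(u) = 0` if `u` is a leaf, and `h(u) = 1 + max_{w child of u} h(w)` otherwise. -/
def Stable (C : PreConfig V) (u : V) : Prop :=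
  (C.IsLeaf u ∧ C.height u = 0) ∨ (¬ C.IsLeaf u ∧ C.height u = 1 + C.maxH u)

/-- `balanced(u)`: `|h(z) − h(z')| ≤ α` for all children `z, z'` of `u`. -/
def Balanced (α : ℤ) (C : PreConfig V) (u : V) : Prop :=
  ∀ z ∈ C.children u, ∀ z' ∈ C.children u, |C.height z - C.height z'| ≤ α

/-- `u` is enabled for a height update iff `¬stable(u)`. -/
def UpdateEnabled (C : PreConfig V) (u : V) : Prop := ¬ C.Stable u

/-- `u` is enabled for a swap iff `stable(u) ∧ stable(max(u)) ∧ ¬balanced(u)`. -/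
def SwapEnabled (α : ℤ) (C : PreConfig V) (u : V) : Prop :=
  C.Stable u ∧ C.Stable (C.maxChild u) ∧ ¬ Balanced α C u

/-- `u` is enabled iff it is enabled for a height update or for a swap. -/
def Enabled (α : ℤ) (C : PreConfig V) (u : V) : Prop :=
  C.UpdateEnabled u ∨ SwapEnabled α C u

/-- The value written by a height update: `0` for a leaf, `1 + max_{w child of u} h(w)` otherwise. -/
noncomputable def newHeight (C : PreConfig V) (u : V) : ℤ :=
  if C.IsLeaf u then 0 else 1 + C.maxH u

/-- A bad node: an internal node `u` with `h(u) ≤ max_{v child of u} h(v)`,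
or a leaf `u` with `h(u) < 0`. -/
def Bad (C : PreConfig V) (u : V) : Prop :=
  (¬ C.IsLeaf u ∧ C.height u ≤ C.maxH u) ∨ (C.IsLeaf u ∧ C.height u < 0)

/-- `v` reaches `a` by iterating the parent map. -/
def Reaches (C : PreConfig V) (v a : V) : Prop :=
  Relation.ReflTransGen (fun x y => C.parent x = some y) v a

/-- The underlying graph is a rooted tree with root `r`: `r` has no parent,
every other node has a (unique) parent, and every node reaches `r` by
iterating the parent map. -/
def IsTree (C : PreConfig V) (r : V) : Prop :=
  C.parent r = none ∧ (∀ v, C.parent v = none → v = r) ∧ ∀ v, C.Reaches v r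

/-- The subtree `S_u` of `u`: the set of descendants of `u` (including `u`). -/
def subtree (C : PreConfig V) (u : V) : Set V := {v | C.Reaches v u}

/-- The actual height `h*(u)` of `u`: the length of a longest directed path
going downward from `u` (such a maximal path necessarily ends at a leaf of `S_u`). -/
noncomputable def hstar (C : PreConfig V) (u : V) : ℕ :=
  sSup {n : ℕ | ∃ f : ℕ → V, f 0 = u ∧ ∀ i < n, C.parent (f (i + 1)) = some (f i)}

/-- An execution step `C →_A C'`: a nonempty set `A` of nodes enabled in `C` is
activated simultaneously; each `u ∈ A` enabled for a height update sets its height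
to `newHeight`; each `u ∈ A` enabled for a swap replaces the edges `(u, min(u))` and
`(max(u), max(max(u)))` by `(u, max(max(u)))` and `(max(u), min(u))` (all guards and
functions evaluated in `C`); everything else is unchanged. -/
structure Step (α : ℤ) (C C' : PreConfig V) (A : Finset V) : Prop where
  nonempty : A.Nonempty
  all_enabled : ∀ u ∈ A, Enabled α C u
  height_update : ∀ u ∈ A, C.UpdateEnabled u → C'.height u = C.newHeight u
  height_keep : ∀ u, ¬ (u ∈ A ∧ C.UpdateEnabled u) → C'.height u = C.height u
  swap_out : ∀ u ∈ A, SwapEnabled α C u → C'.parent (C.minChild u) = some (C.maxChild u)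
  swap_in : ∀ u ∈ A, SwapEnabled α C u → C'.parent (C.maxChild (C.maxChild u)) = some u
  parent_keep : ∀ v, (∀ u ∈ A, SwapEnabled α C u →
      v ≠ C.minChild u ∧ v ≠ C.maxChild (C.maxChild u)) → C'.parent v = C.parent v

end PreConfig

namespace PreConfig

variable {V : Type*} [Fintype V] [LinearOrder V]

lemma mem_children {C : PreConfig V} {u v : V} :
    v ∈ C.children u ↔ C.parent v = some u := by
  simp [children]

lemma not_isLeaf_iff {C : PreConfig V} {u : V} :
    ¬ C.IsLeaf u ↔ ∃ v, C.parent v = some u := by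
  simp [IsLeaf, ← Finset.nonempty_iff_ne_empty, Finset.Nonempty, mem_children]

lemma height_le_maxH {C : PreConfig V} {u v : V}
    (hv : C.parent v = some u) : C.height v ≤ C.maxH u := by
  have hv' := mem_children.2 hv
  rw [maxH, dif_pos ⟨v, hv'⟩]
  exact Finset.le_sup' C.height hv'

lemma minH_le_height {C : PreConfig V} {u v : V}
    (hv : C.parent v = some u) : C.minH u ≤ C.height v := by
  have hv' := mem_children.2 hv
  rw [minH, dif_pos ⟨v, hv'⟩]
  exact Finset.inf'_le C.height hv'

lemma exists_height_eq_maxH {C : PreConfig V} {u : V}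
    (hu : ¬ C.IsLeaf u) : ∃ v ∈ C.children u, C.height v = C.maxH u := by
  have hne : (C.children u).Nonempty := Finset.nonempty_iff_ne_empty.2 hu
  obtain ⟨v, hv, h⟩ := Finset.exists_mem_eq_sup' hne C.height
  exact ⟨v, hv, by rw [maxH, dif_pos hne, h]⟩

lemma exists_height_eq_minH {C : PreConfig V} {u : V}
    (hu : ¬ C.IsLeaf u) : ∃ v ∈ C.children u, C.height v = C.minH u := by
  have hne : (C.children u).Nonempty := Finset.nonempty_iff_ne_empty.2 hu
  obtain ⟨v, hv, h⟩ := Finset.exists_mem_eq_inf' hne C.height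
  exact ⟨v, hv, by rw [minH, dif_pos hne, h]⟩

lemma maxChild_spec {C : PreConfig V} {u : V}
    (hu : ¬ C.IsLeaf u) :
    C.parent (C.maxChild u) = some u ∧ C.height (C.maxChild u) = C.maxH u := by
  have hne : ((C.children u).filter fun v => C.height v = C.maxH u).Nonempty := by
    obtain ⟨v, hv, h⟩ := exists_height_eq_maxH hu
    exact ⟨v, Finset.mem_filter.2 ⟨hv, h⟩⟩
  have hmem := Finset.min'_mem _ hne
  rw [maxChild, dif_pos hne]
  rwa [Finset.mem_filter, mem_children] at hmem

lemma minChild_spec {C : PreConfig V} {u : V}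
    (hu : ¬ C.IsLeaf u) :
    C.parent (C.minChild u) = some u ∧ C.height (C.minChild u) = C.minH u := by
  have hne : ((C.children u).filter fun v => C.height v = C.minH u).Nonempty := by
    obtain ⟨v, hv, h⟩ := exists_height_eq_minH hu
    exact ⟨v, Finset.mem_filter.2 ⟨hv, h⟩⟩
  have hmem := Finset.min'_mem _ hne
  rw [minChild, dif_pos hne]
  rwa [Finset.mem_filter, mem_children] at hmem

/-- For a leaf `u`, `max(u)` is the junk value `u`. -/
lemma maxChild_of_isLeaf {C : PreConfig V} {u : V}
    (hu : C.IsLeaf u) : C.maxChild u = u := by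
  have hu' : C.children u = ∅ := hu
  simp [maxChild, hu']

lemma bad_iff_height_lt_newHeight {C : PreConfig V} {u : V} :
    C.Bad u ↔ C.height u < C.newHeight u := by
  by_cases h : C.IsLeaf u <;> simp [Bad, newHeight, h] <;> omega

lemma not_isLeaf_of_not_balanced {α : ℤ} {C : PreConfig V} {u : V}
    (hu : ¬ Balanced α C u) : ¬ C.IsLeaf u := by
  intro h
  have h' : C.children u = ∅ := h
  exact hu (by simp [Balanced, h'])

lemma minH_lt_maxH_of_not_balanced {α : ℤ} (hα : 0 ≤ α)
    {C : PreConfig V} {u : V} (hu : ¬ Balanced α C u) : C.minH u < C.maxH u := by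
  by_contra! hle
  refine hu fun z hz z' hz' => ?_
  rw [mem_children] at hz hz'
  have h₁ := height_le_maxH hz
  have h₂ := minH_le_height hz
  have h₃ := height_le_maxH hz'
  have h₄ := minH_le_height hz'
  rw [abs_le]
  constructor <;> omega

/-- A step does not increase the height of a node unless it updates that node while bad. -/
lemma Step.height_le {α : ℤ} {C C' : PreConfig V}
    {A : Finset V} (hstep : Step α C C' A) {v : V}
    (hv : ¬ (v ∈ A ∧ C.Bad v ∧ C.UpdateEnabled v)) : C'.height v ≤ C.height v := by
  by_cases h : v ∈ A ∧ C.UpdateEnabled v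
  · have hbad : ¬ C.Bad v := fun hb => hv ⟨h.1, hb, h.2⟩
    rw [hstep.height_update v h.1 h.2]
    exact not_lt.1 (bad_iff_height_lt_newHeight.not.1 hbad)
  · exact (hstep.height_keep v h).le

/-- A node gained as a child by a node `u` that is not activated is `min(w)` for a source `w` with target `u`. -/
lemma Step.parent_eq_or_of_notMem {α : ℤ}
    {C C' : PreConfig V} {A : Finset V} (hstep : Step α C C' A) {u v : V} (hu : u ∉ A)
    (hv : C'.parent v = some u) :
    C.parent v = some u ∨ ∃ w ∈ A, SwapEnabled α C w ∧ v = C.minChild w ∧ u = C.maxChild w := by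
  by_cases hkeep : ∀ w ∈ A, SwapEnabled α C w →
      v ≠ C.minChild w ∧ v ≠ C.maxChild (C.maxChild w)
  · exact Or.inl (hstep.parent_keep v hkeep ▸ hv)
  · push Not at hkeep
    obtain ⟨w, hwA, hw, hvw⟩ := hkeep
    by_cases hmin : v = C.minChild w
    · have h := hstep.swap_out w hwA hw
      rw [← hmin, hv] at h
      exact Or.inr ⟨w, hwA, hw, hmin, Option.some.inj h⟩
    · have h := hstep.swap_in w hwA hw
      rw [← hvw hmin, hv] at h
      exact absurd (Option.some.inj h ▸ hwA) hu

/-- An internal node which is not activated does not become a leaf. -/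
lemma Step.not_isLeaf {α : ℤ}
    {C C' : PreConfig V} {A : Finset V} (hstep : Step α C C' A) {u : V} (hu : u ∉ A)
    (hleaf : ¬ C.IsLeaf u) : ¬ C'.IsLeaf u := by
  obtain ⟨v, hv⟩ := not_isLeaf_iff.1 hleaf
  rw [not_isLeaf_iff]
  by_cases hkeep : ∀ w ∈ A, SwapEnabled α C w →
      v ≠ C.minChild w ∧ v ≠ C.maxChild (C.maxChild w)
  · exact ⟨v, (hstep.parent_keep v hkeep).trans hv⟩
  · push Not at hkeep
    obtain ⟨w, hwA, hw, hvw⟩ := hkeep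
    have hwleaf := not_isLeaf_of_not_balanced hw.2.2
    have hne : u ≠ w := fun h => hu (h ▸ hwA)
    by_cases hmin : v = C.minChild w
    · have h := (minChild_spec hwleaf).1
      rw [← hmin, hv] at h
      exact absurd (Option.some.inj h) hne
    · have hmax := hvw hmin
      by_cases hm : C.IsLeaf (C.maxChild w)
      · rw [maxChild_of_isLeaf hm] at hmax
        have h := (maxChild_spec hwleaf).1
        rw [← hmax, hv] at h
        exact absurd (Option.some.inj h) hne
      · have h := (maxChild_spec hm).1
        rw [← hmax, hv] at h
        exact ⟨C.minChild w, (hstep.swap_out w hwA hw).trans h.symm⟩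

end PreConfig

/-- Let `C →_A C'` be an execution step and `u` a node with
`u ∉ A ∪ B` and `children'(u) ∩ A_b = ∅` (no child of `u` in `C'` is an activated
bad node performing a height update). Then `u ∉ B'`. -/
theorem stmt11 {V : Type*} [Fintype V] [LinearOrder V] (α : ℤ) (hα : 1 ≤ α)
    (C C' : PreConfig V) (A : Finset V) (r : V)
    (hT : C.IsTree r) (hstep : PreConfig.Step α C C' A)
    (u : V) (huA : u ∉ A) (huB : ¬ C.Bad u)
    (hch : ∀ v ∈ C'.children u, ¬ (v ∈ A ∧ C.Bad v ∧ C.UpdateEnabled v)) :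
    ¬ C'.Bad u := by
  have hu : C'.height u = C.height u := hstep.height_keep u fun h => huA h.1
  rintro (⟨hleaf, hle⟩ | ⟨hleaf, hlt⟩)
  · obtain ⟨v, hv, hvmax⟩ := PreConfig.exists_height_eq_maxH hleaf
    have hvle := hstep.height_le (hch v hv)
    rw [PreConfig.mem_children] at hv
    rcases hstep.parent_eq_or_of_notMem huA hv with hvu | ⟨w, -, hw, rfl, rfl⟩
    · have hmax := PreConfig.height_le_maxH hvu
      exact huB (Or.inl ⟨PreConfig.not_isLeaf_iff.2 ⟨v, hvu⟩, by omega⟩)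
    · have hwleaf := PreConfig.not_isLeaf_of_not_balanced hw.2.2
      have hlt := PreConfig.minH_lt_maxH_of_not_balanced (by omega) hw.2.2
      have h₁ := (PreConfig.maxChild_spec hwleaf).2
      have h₂ := (PreConfig.minChild_spec hwleaf).2
      omega
  · have hleafC : C.IsLeaf u := by
      by_contra h
      exact hstep.not_isLeaf huA h hleaf
    exact huB (Or.inr ⟨hleafC, by omega⟩)
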